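/- Let M be a nonempty closed convex set of states on a finite-dimensional Hilbert space K containing a full-rank state, let π be a state on K, and let K₀ > 0 be a real number. Then the following strong duality holds: max{ tr(Aπ) : 0 ≤ A ≤ I, and tr(Aσ) ≤ 1/K₀ for all σ ∈ M } = min{ tr(π − b·μ)₊ + b/K₀ : μ ∈ M, b ∈ ℝ, b ≥ 0 }. -/

import Mathlib

open scoped BigOperators
open Filter ComplexOrder

noncomputable section

namespace GQSL

variable {I : Type*} [Fintype I] [DecidableEq I]

/-- A quantum state: a positive semidefinite matrix of unit trace. -/
def IsState (ρ : Matrix I I ℂ) : Prop := ρ.PosSemidef ∧ ρ.trace = 1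

/-- The `n`-fold tensor power of an operator, realized on `Fin n → I` indices. -/
def tpow (ρ : Matrix I I ℂ) (n : ℕ) : Matrix (Fin n → I) (Fin n → I) ℂ :=
  fun x y => ∏ i, ρ (x i) (y i)

/-- Functional calculus for Hermitian matrices (junk value `0` otherwise). -/
def fcal (f : ℝ → ℝ) (A : Matrix I I ℂ) : Matrix I I ℂ :=
  if hA : A.IsHermitian then
    (hA.eigenvectorUnitary : Matrix I I ℂ) *
      Matrix.diagonal (fun i => (f (hA.eigenvalues i) : ℂ)) *
      star (hA.eigenvectorUnitary : Matrix I I ℂ)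
  else 0

/-- Base-2 matrix logarithm, computed on the support. -/
def mlog (A : Matrix I I ℂ) : Matrix I I ℂ :=
  fcal (fun x => if 0 < x then Real.logb 2 x else 0) A

/-- Real matrix power, computed on the support (generalized inverse powers). -/
def mpow (A : Matrix I I ℂ) (t : ℝ) : Matrix I I ℂ :=
  fcal (fun x => if 0 < x then x ^ t else 0) A

/-- Matrix square root of a positive semidefinite matrix. -/
def msqrt (A : Matrix I I ℂ) : Matrix I I ℂ := fcal Real.sqrt A

/-- Trace norm `‖A‖₁ = tr √(AᴴA)`. -/
def trNorm (A : Matrix I I ℂ) : ℝ := ((msqrt (A.conjTranspose * A)).trace).re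

/-- Trace of the positive part of a Hermitian matrix: the sum of its positive eigenvalues. -/
def trPos (A : Matrix I I ℂ) : ℝ := ((fcal (fun x => max x 0) A).trace).re

/-- Fidelity `F(A,B) = tr √(√A B √A)`. -/
def fid (A B : Matrix I I ℂ) : ℝ := ((msqrt (msqrt A * B * msqrt A)).trace).re

/-- Von Neumann entropy (base 2). -/
def vnEnt (A : Matrix I I ℂ) : ℝ := -((A * mlog A).trace).re

/-- `supp ρ ⊆ supp σ`, expressed via kernels. -/
def SuppLe (ρ σ : Matrix I I ℂ) : Prop := ∀ v, σ.mulVec v = 0 → ρ.mulVec v = 0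

/-- Quantum relative entropy `S(ρ‖σ) = tr(ρ(log₂ρ − log₂σ))` (finite-value formula,
meaningful when `SuppLe ρ σ` holds). -/
def relEnt (ρ σ : Matrix I I ℂ) : ℝ := ((ρ * (mlog ρ - mlog σ)).trace).re

/-- `E_M(ρ) = inf {S(ρ‖σ) : σ ∈ M}`; states `σ` violating the support condition
have `S(ρ‖σ) = +∞` and hence do not contribute to the infimum. -/
def EMset (M : Set (Matrix I I ℂ)) (ρ : Matrix I I ℂ) : ℝ :=
  sInf {x | ∃ σ ∈ M, SuppLe ρ σ ∧ x = relEnt ρ σ}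

/-- Max-relative entropy `S_max(ρ‖σ) = inf {s : ρ ≤ 2^s σ}`. -/
def Smax (ρ σ : Matrix I I ℂ) : ℝ := sInf {s : ℝ | (((2:ℝ) ^ s) • σ - ρ).PosSemidef}

/-- Log robustness with respect to a set `M`. -/
def LR (M : Set (Matrix I I ℂ)) (ρ : Matrix I I ℂ) : ℝ :=
  sInf {x | ∃ σ ∈ M, x = Smax ρ σ}

/-- Smoothed log robustness. -/
def LReps (M : Set (Matrix I I ℂ)) (ε : ℝ) (ρ : Matrix I I ℂ) : ℝ :=
  sInf {x | ∃ ρ', IsState ρ' ∧ trNorm (ρ' - ρ) ≤ ε ∧ x = LR M ρ'}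

/-- Partial trace over the `k`-th tensor factor. -/
def ptraceAt {n : ℕ} (k : Fin (n + 1)) (ρ : Matrix (Fin (n + 1) → I) (Fin (n + 1) → I) ℂ) :
    Matrix (Fin n → I) (Fin n → I) ℂ :=
  fun x y => ∑ a : I, ρ (k.insertNth a x) (k.insertNth a y)

/-- Tensor product of operators on `n` and `m` copies. -/
def tprod {n m : ℕ} (ρ : Matrix (Fin n → I) (Fin n → I) ℂ)
    (ν : Matrix (Fin m → I) (Fin m → I) ℂ) :
    Matrix (Fin (n + m) → I) (Fin (n + m) → I) ℂ :=
  fun x y => ρ (fun i => x (Fin.castAdd m i)) (fun i => y (Fin.castAdd m i)) *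
    ν (fun j => x (Fin.natAdd n j)) (fun j => y (Fin.natAdd n j))

/-- Conjugation `P_π ρ P_π†` by the permutation unitary. -/
def permute {n : ℕ} (π : Equiv.Perm (Fin n)) (ρ : Matrix (Fin n → I) (Fin n → I) ℂ) :
    Matrix (Fin n → I) (Fin n → I) ℂ :=
  fun x y => ρ (x ∘ π) (y ∘ π)

/-- A family of sets of states satisfying properties 1–5, with `σ` the fixed
full-rank state of property 2. -/
structure GoodFamily {d : ℕ} (σ : Matrix (Fin d) (Fin d) ℂ)
    (M : ∀ n : ℕ, Set (Matrix (Fin n → Fin d) (Fin n → Fin d) ℂ)) : Prop where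
  states : ∀ n, ∀ ρ ∈ M n, IsState ρ
  convex : ∀ n, Convex ℝ (M n)
  closed : ∀ n, IsClosed (M n)
  sigma_state : IsState σ
  sigma_posdef : σ.PosDef
  sigma_mem : ∀ n, tpow σ n ∈ M n
  ptrace_mem : ∀ n (k : Fin (n + 1)), ∀ ρ ∈ M (n + 1), ptraceAt k ρ ∈ M n
  tprod_mem : ∀ n m, ∀ ρ ∈ M n, ∀ ν ∈ M m, tprod ρ ν ∈ M (n + m)
  perm_mem : ∀ n (π : Equiv.Perm (Fin n)), ∀ ρ ∈ M n, permute π ρ ∈ M n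

/-- The rank-one operator `|f⟩⟨f|`. -/
def vecOp {J : Type*} (f : J → ℂ) : Matrix J J ℂ := fun x y => f x * star (f y)

/-- Squared ℓ²-norm of a vector. -/
def vecNormSq {J : Type*} [Fintype J] (f : J → ℂ) : ℝ := ∑ x, Complex.normSq (f x)

/-- ℓ²-norm of a vector. -/
def l2norm {J : Type*} [Fintype J] (f : J → ℂ) : ℝ := Real.sqrt (vecNormSq f)

/-- Membership in the symmetric subspace. -/
def IsSymVec {J : Type*} {N : ℕ} (f : (Fin N → J) → ℂ) : Prop :=
  ∀ (π : Equiv.Perm (Fin N)) (x : Fin N → J), f (x ∘ π) = f x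

/-- Unnormalized symmetrization `Σ_π P_π ψ`. -/
def symmetrize {J : Type*} {N : ℕ} (ψ : (Fin N → J) → ℂ) : (Fin N → J) → ℂ :=
  fun x => ∑ π : Equiv.Perm (Fin N), ψ (x ∘ π)

/-- Normalized symmetrization `Sym(ψ)`. -/
def SymOf {J : Type*} [Fintype J] {N : ℕ} (ψ : (Fin N → J) → ℂ) : (Fin N → J) → ℂ :=
  ((l2norm (symmetrize ψ) : ℂ))⁻¹ • symmetrize ψ

/-- Partial trace over the first `m` of `m + k` tensor factors. -/
def ptraceFirst {J : Type*} [Fintype J] [DecidableEq J] {m k : ℕ}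
    (ρ : Matrix (Fin (m + k) → J) (Fin (m + k) → J) ℂ) :
    Matrix (Fin k → J) (Fin k → J) ℂ :=
  fun x y => ∑ a : Fin m → J, ρ (Fin.append a x) (Fin.append a y)

/-- Partial trace over the environment components of `N` system–environment pairs. -/
def ptraceE {A E : Type*} [Fintype A] [Fintype E] {N : ℕ}
    (ρ : Matrix (Fin N → A × E) (Fin N → A × E) ℂ) :
    Matrix (Fin N → A) (Fin N → A) ℂ :=
  fun x y => ∑ e : Fin N → E, ρ (fun i => (x i, e i)) (fun i => (y i, e i))

/-- The set of `(N choose r)`-i.i.d. vectors along `θ`: vectors which are `θ` on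
`N − r` of the positions (the permutations of `θ^{⊗(N−r)} ⊗ ψ_r`). -/
def powVecSet {J : Type*} (θ : J → ℂ) (N r : ℕ) : Set ((Fin N → J) → ℂ) :=
  {f | ∃ S : Finset (Fin N), S.card = N - r ∧
    ∃ ψ : ({i : Fin N // i ∉ S} → J) → ℂ,
      f = fun x => (∏ i ∈ S, θ (x i)) * ψ (fun j => x j.1)}

/-- Almost power states along `θ`: `|θ⟩^{[⊗,N,r]} = Sym(ℋ^{⊗N}) ∩ span V(ℋ^{⊗N}, θ^{⊗N−r})`. -/
def almostPower {J : Type*} (θ : J → ℂ) (N r : ℕ) : Set ((Fin N → J) → ℂ) :=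
  {f | IsSymVec f ∧ f ∈ Submodule.span ℂ (powVecSet θ N r)}

/-- `η ⊗ θ^{⊗(N−k)}`: the vector `η` on the first `k` slots and `θ` on the rest. -/
def etaTensor {J : Type*} {N k : ℕ} (h : k ≤ N) (η : (Fin k → J) → ℂ) (θ : J → ℂ) :
    (Fin N → J) → ℂ :=
  fun x => η (fun i => x (Fin.castLE h i)) * ∏ i : Fin N, if (i : ℕ) < k then 1 else θ (x i)

/-- `η` lies in the `k`-fold tensor power of the orthogonal complement of `θ`:
the contraction of `η` with `⟨θ|` at any slot vanishes. -/
def InPerpPow {J : Type*} [Fintype J] [DecidableEq J] {k : ℕ} (θ : J → ℂ)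
    (η : (Fin k → J) → ℂ) : Prop :=
  ∀ (j : Fin k) (z : Fin k → J), ∑ a : J, star (θ a) * η (Function.update z j a) = 0

/-- Binary Shannon entropy. -/
def binEnt (x : ℝ) : ℝ := -(x * Real.logb 2 x) - (1 - x) * Real.logb 2 (1 - x)

/-- Product operator `σ₁ ⊗ ⋯ ⊗ σ_k` of a `k`-partite system. -/
def prodOp {k : ℕ} {ι : Fin k → Type*} [∀ i, Fintype (ι i)]
    (σs : ∀ i, Matrix (ι i) (ι i) ℂ) : Matrix (∀ i, ι i) (∀ i, ι i) ℂ :=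
  fun x y => ∏ i, σs i (x i) (y i)

/-- Separability of a `k`-partite state: a finite convex combination of product states. -/
def IsSeparable {k : ℕ} {ι : Fin k → Type*} [∀ i, Fintype (ι i)]
    (ρ : Matrix (∀ i, ι i) (∀ i, ι i) ℂ) : Prop :=
  ∃ (m : ℕ) (p : Fin m → ℝ) (σs : Fin m → ∀ i, Matrix (ι i) (ι i) ℂ),
    (∀ j, 0 ≤ p j) ∧ (∑ j, p j = 1) ∧ (∀ j i, IsState (σs j i)) ∧
    ρ = ∑ j, p j • prodOp (σs j)

/-- Relative entropy of entanglement `E_R(ρ) = inf {S(ρ‖ω) : ω separable}`. -/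
def ERel {k : ℕ} {ι : Fin k → Type*} [∀ i, Fintype (ι i)] [∀ i, DecidableEq (ι i)]
    (ρ : Matrix (∀ i, ι i) (∀ i, ι i) ℂ) : ℝ :=
  sInf {x | ∃ ω, IsSeparable ω ∧ SuppLe ρ ω ∧ x = relEnt ρ ω}

/-- `ρ^{⊗n}` of a `k`-partite state, viewed as a `k`-partite state where the `i`-th
party holds the `n` copies of its system. -/
def tpowMulti {k : ℕ} {d : Fin k → ℕ} (ρ : Matrix (∀ i, Fin (d i)) (∀ i, Fin (d i)) ℂ)
    (n : ℕ) : Matrix (∀ i, Fin n → Fin (d i)) (∀ i, Fin n → Fin (d i)) ℂ :=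
  fun x y => ∏ t : Fin n, ρ (fun i => x i t) (fun i => y i t)

/-- `ρ^{⊗n}` of a bipartite state in the grouped bipartition `A^{⊗n} : B^{⊗n}`. -/
def tpowBi {A B : Type*} [Fintype A] [Fintype B]
    (ρ : Matrix (A × B) (A × B) ℂ) (n : ℕ) :
    Matrix ((Fin n → A) × (Fin n → B)) ((Fin n → A) × (Fin n → B)) ℂ :=
  fun x y => ∏ i, ρ (x.1 i, x.2 i) (y.1 i, y.2 i)

/-- `k`-extendibility of a bipartite state. -/
def IsKExtendible {A B : Type*} [Fintype A] [Fintype B] (k : ℕ)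
    (σ : Matrix (A × B) (A × B) ℂ) : Prop :=
  ∃ σ' : Matrix (A × (Fin k → B)) (A × (Fin k → B)) ℂ,
    IsState σ' ∧
    (∀ (π : Equiv.Perm (Fin k)) (p q : A × (Fin k → B)),
      σ' (p.1, p.2 ∘ π) (q.1, q.2 ∘ π) = σ' p q) ∧
    (∀ p q : A × B, σ p q =
      ∑ f : {i : Fin k // (i : ℕ) ≠ 0} → B,
        σ' (p.1, fun i => if h : (i : ℕ) = 0 then p.2 else f ⟨i, h⟩)
           (q.1, fun i => if h : (i : ℕ) = 0 then q.2 else f ⟨i, h⟩))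

/-- The trace pairing with a Hermitian matrix, computed in its eigenbasis. -/
lemma re_trace_mul_eq_sum_eigenvalues {H : Matrix I I ℂ} (hH : H.IsHermitian) (A : Matrix I I ℂ) :
    ((A * H).trace).re = ∑ i, hH.eigenvalues i *
      ((star (hH.eigenvectorUnitary : Matrix I I ℂ) * A *
        (hH.eigenvectorUnitary : Matrix I I ℂ)) i i).re := by
  have hspec : H = (hH.eigenvectorUnitary : Matrix I I ℂ) *
      Matrix.diagonal (fun i => (hH.eigenvalues i : ℂ)) *
      star (hH.eigenvectorUnitary : Matrix I I ℂ) := by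
    conv_lhs => rw [hH.spectral_theorem, Unitary.conjStarAlgAut_apply]
    rfl
  generalize hH.eigenvalues = e at *
  generalize (hH.eigenvectorUnitary : Matrix I I ℂ) = U at *
  have htr : (A * H).trace =
      (star U * A * U * Matrix.diagonal (fun i => (e i : ℂ))).trace := by
    rw [hspec, ← Matrix.mul_assoc, Matrix.trace_mul_comm]
    simp only [Matrix.mul_assoc]
  rw [htr, Matrix.trace, Complex.re_sum]
  refine Finset.sum_congr rfl fun i _ => ?_
  rw [Matrix.diag_apply, Matrix.mul_diagonal, mul_comm, Complex.re_ofReal_mul]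

lemma trPos_eq_sum_eigenvalues {H : Matrix I I ℂ} (hH : H.IsHermitian) :
    trPos H = ∑ i, max (hH.eigenvalues i) 0 := by
  rw [trPos, fcal, dif_pos hH, Matrix.trace_mul_cycle, Unitary.coe_star_mul_self, one_mul,
    Matrix.trace_diagonal, Complex.re_sum]
  simp

lemma star_mul_mul_eigenvectorUnitary_diag_re_nonneg {H A : Matrix I I ℂ} (hH : H.IsHermitian)
    (hA : A.PosSemidef) (i : I) :
    0 ≤ ((star (hH.eigenvectorUnitary : Matrix I I ℂ) * A *
      (hH.eigenvectorUnitary : Matrix I I ℂ)) i i).re :=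
  (Complex.nonneg_iff.1
    (hA.conjTranspose_mul_mul_same (hH.eigenvectorUnitary : Matrix I I ℂ)).diag_nonneg).1

lemma re_trace_mul_nonneg {A B : Matrix I I ℂ} (hA : A.PosSemidef) (hB : B.PosSemidef) :
    0 ≤ ((A * B).trace).re := by
  rw [re_trace_mul_eq_sum_eigenvalues hB.isHermitian]
  exact Finset.sum_nonneg fun i _ => mul_nonneg (hB.eigenvalues_nonneg i)
    (star_mul_mul_eigenvectorUnitary_diag_re_nonneg _ hA i)

lemma re_trace_mul_le_trPos {A H : Matrix I I ℂ} (hA : A.PosSemidef) (hA' : (1 - A).PosSemidef)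
    (hH : H.IsHermitian) : ((A * H).trace).re ≤ trPos H := by
  rw [re_trace_mul_eq_sum_eigenvalues hH, trPos_eq_sum_eigenvalues hH]
  refine Finset.sum_le_sum fun i _ => ?_
  have h0 := star_mul_mul_eigenvectorUnitary_diag_re_nonneg hH hA i
  have h1 := star_mul_mul_eigenvectorUnitary_diag_re_nonneg hH hA' i
  rw [mul_sub, sub_mul, mul_one, Unitary.coe_star_mul_self, Matrix.sub_apply,
    Matrix.one_apply_eq, Complex.sub_re, Complex.one_re] at h1
  nlinarith [le_max_left (hH.eigenvalues i) 0, le_max_right (hH.eigenvalues i) 0]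

/-- The spectral projection onto the positive eigenspaces attains the trace of the positive part. -/
lemma exists_re_trace_mul_eq_trPos {H : Matrix I I ℂ} (hH : H.IsHermitian) :
    ∃ A : Matrix I I ℂ, A.PosSemidef ∧ (1 - A).PosSemidef ∧ ((A * H).trace).re = trPos H := by
  have hUU : star (hH.eigenvectorUnitary : Matrix I I ℂ) * (hH.eigenvectorUnitary : Matrix I I ℂ)
    = 1 := Unitary.coe_star_mul_self _
  have hUU' : (hH.eigenvectorUnitary : Matrix I I ℂ) * star (hH.eigenvectorUnitary : Matrix I I ℂ)
    = 1 := Unitary.coe_mul_star_self _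
  set P : Matrix I I ℂ := Matrix.diagonal fun i => if 0 < hH.eigenvalues i then 1 else 0 with hP
  refine ⟨(hH.eigenvectorUnitary : Matrix I I ℂ) * P *
    star (hH.eigenvectorUnitary : Matrix I I ℂ), ?_, ?_, ?_⟩
  · refine Matrix.PosSemidef.mul_mul_conjTranspose_same (.diagonal fun i => ?_) _
    by_cases h : 0 < hH.eigenvalues i <;> simp [h]
  · have h1P : (1 - P).PosSemidef := by
      rw [hP, ← Matrix.diagonal_one, Matrix.diagonal_sub]
      refine .diagonal fun i => ?_
      by_cases h : 0 < hH.eigenvalues i <;> simp [h]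
    have := h1P.mul_mul_conjTranspose_same (hH.eigenvectorUnitary : Matrix I I ℂ)
    rwa [← Matrix.star_eq_conjTranspose, mul_sub, sub_mul, mul_one, hUU'] at this
  · rw [re_trace_mul_eq_sum_eigenvalues hH, trPos_eq_sum_eigenvalues hH]
    refine Finset.sum_congr rfl fun i _ => ?_
    have hconj : star (hH.eigenvectorUnitary : Matrix I I ℂ) *
        ((hH.eigenvectorUnitary : Matrix I I ℂ) * P *
          star (hH.eigenvectorUnitary : Matrix I I ℂ)) *
        (hH.eigenvectorUnitary : Matrix I I ℂ) = P := by
      simp only [← Matrix.mul_assoc, hUU, one_mul]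
      rw [Matrix.mul_assoc, hUU, mul_one]
    rw [hconj, hP, Matrix.diagonal_apply_eq]
    split_ifs with h
    · simp [h.le]
    · simp [not_lt.1 h]

lemma isClosed_setOf_posSemidef : IsClosed {A : Matrix I I ℂ | A.PosSemidef} := by
  simp only [Matrix.posSemidef_iff_dotProduct_mulVec, Set.ofPred_and, Set.ofPred_forall]
  refine IsClosed.inter (isClosed_eq (by fun_prop) (by fun_prop)) (isClosed_iInter fun x => ?_)
  exact isClosed_le continuous_const (by fun_prop)

lemma norm_apply_le_re_trace {A : Matrix I I ℂ} (hA : A.PosSemidef) (i j : I) :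
    ‖A i j‖ ≤ A.trace.re := by
  have hdiag (k : I) : 0 ≤ (A k k).re := (Complex.nonneg_iff.1 hA.diag_nonneg).1
  have hle (k : I) : (A k k).re ≤ A.trace.re := by
    rw [Matrix.trace, Complex.re_sum]
    exact Finset.single_le_sum (f := fun k => (A k k).re) (fun k _ => hdiag k) (Finset.mem_univ k)
  have hdet := (hA.submatrix ![i, j]).det_nonneg
  rw [Matrix.det_fin_two] at hdet
  have hre := (Complex.nonneg_iff.1 hdet).1
  have hji : A j i = star (A i j) := (hA.isHermitian.apply j i).symm
  have hii : (A i i).im = 0 := (Complex.nonneg_iff.1 hA.diag_nonneg).2.symm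
  simp only [Matrix.submatrix_apply, Matrix.cons_val_zero, Matrix.cons_val_one, hji,
    Complex.sub_re, Complex.mul_re, hii, Complex.star_def, Complex.conj_re,
    Complex.conj_im] at hre
  refine abs_le_of_sq_le_sq' ?_ ((hdiag i).trans (hle i)) |>.2
  rw [← Complex.normSq_eq_norm_sq, Complex.normSq_apply]
  nlinarith [mul_le_mul (hle i) (hle j) (hdiag j) ((hdiag i).trans (hle i))]

lemma isCompact_setOf_posSemidef_re_trace_le (t : ℝ) :
    IsCompact {A : Matrix I I ℂ | A.PosSemidef ∧ A.trace.re ≤ t} := by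
  have hbox : IsCompact (Set.univ.pi fun _ : I => Set.univ.pi fun _ : I =>
      Metric.closedBall (0 : ℂ) t) :=
    isCompact_univ_pi fun _ => isCompact_univ_pi fun _ => isCompact_closedBall 0 t
  refine hbox.of_isClosed_subset ?_ fun A hA i _ j _ => ?_
  · exact isClosed_setOf_posSemidef.inter
      (isClosed_le (Complex.continuous_re.comp (by fun_prop)) continuous_const)
  · simpa using (norm_apply_le_re_trace hA.1 i j).trans hA.2

lemma convex_setOf_posSemidef : Convex ℝ {A : Matrix I I ℂ | A.PosSemidef} :=
  fun _ hA _ hB _ _ ha hb _ => (hA.smul ha).add (hB.smul hb)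

/-- The effects, i.e. the operators between `0` and `1`. -/
def effects (I : Type*) [Fintype I] [DecidableEq I] : Set (Matrix I I ℂ) :=
  {A | A.PosSemidef ∧ (1 - A).PosSemidef}

lemma convex_effects : Convex ℝ (effects I) := by
  intro A hA B hB a b ha hb hab
  refine ⟨convex_setOf_posSemidef hA.1 hB.1 ha hb hab, ?_⟩
  have h := convex_setOf_posSemidef hA.2 hB.2 ha hb hab
  have heq : a • (1 - A) + b • (1 - B) = 1 - (a • A + b • B) := by
    rw [smul_sub, smul_sub, sub_add_sub_comm, ← add_smul, hab, one_smul]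
  rwa [heq] at h

lemma isCompact_effects : IsCompact (effects I) := by
  refine (isCompact_setOf_posSemidef_re_trace_le
    (1 : Matrix I I ℂ).trace.re).of_isClosed_subset ?_ fun A hA => ⟨hA.1, ?_⟩
  · exact isClosed_setOf_posSemidef.inter
      (isClosed_setOf_posSemidef.preimage (continuous_const.sub continuous_id))
  · have h := (Complex.nonneg_iff.1 hA.2.trace_nonneg).1
    rwa [Matrix.trace_sub, Complex.sub_re, sub_nonneg] at h

lemma isCompact_of_isClosed_of_isState {M : Set (Matrix I I ℂ)} (hM : ∀ σ ∈ M, IsState σ)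
    (hMc : IsClosed M) : IsCompact M :=
  (isCompact_setOf_posSemidef_re_trace_le 1).of_isClosed_subset hMc fun σ hσ =>
    ⟨(hM σ hσ).1, by simp [(hM σ hσ).2]⟩

/-- The cone over `M`, truncated at height `B`. -/
def truncCone (M : Set (Matrix I I ℂ)) (B : ℝ) : Set (Matrix I I ℂ) :=
  (fun p : ℝ × Matrix I I ℂ => p.1 • p.2) '' (Set.Icc 0 B ×ˢ M)

lemma convex_truncCone {M : Set (Matrix I I ℂ)} (hM : Convex ℝ M) (B : ℝ) :
    Convex ℝ (truncCone M B) := by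
  rintro _ ⟨⟨s, μ⟩, ⟨⟨hs0, hsB⟩, hμ⟩, rfl⟩ _ ⟨⟨t, ν⟩, ⟨⟨ht0, htB⟩, hν⟩, rfl⟩ a b ha hb hab
  simp only at hs0 hsB ht0 htB hμ hν
  have has := mul_nonneg ha hs0
  have hbt := mul_nonneg hb ht0
  have hB : a * s + b * t ≤ B := by
    calc a * s + b * t ≤ a * B + b * B := by gcongr
      _ = B := by rw [← add_mul, hab, one_mul]
  rcases (add_nonneg has hbt).eq_or_lt with h0 | hpos
  · have h1 : a * s = 0 := by linarith
    have h2 : b * t = 0 := by linarith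
    exact ⟨(0, μ), ⟨⟨le_rfl, hs0.trans hsB⟩, hμ⟩, by simp [smul_smul, h1, h2]⟩
  · refine ⟨(a * s + b * t, (a * s / (a * s + b * t)) • μ + (b * t / (a * s + b * t)) • ν),
      ⟨⟨hpos.le, hB⟩, hM hμ hν (by positivity) (by positivity) ?_⟩, ?_⟩
    · rw [← add_div, div_self hpos.ne']
    · simp only [smul_add, smul_smul, mul_div_cancel₀ _ hpos.ne']

/-- The Lagrangian of the hypothesis-testing problem, in the multiplier `ν = b μ`. -/
def lagrangian (π : Matrix I I ℂ) (K₀ : ℝ) (ν A : Matrix I I ℂ) : ℝ :=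
  ((A * (π - ν)).trace).re + ν.trace.re / K₀

lemma exists_isSaddlePointOn_lagrangian {M : Set (Matrix I I ℂ)} (hMne : M.Nonempty)
    (hMstates : ∀ σ ∈ M, IsState σ) (hMconv : Convex ℝ M) (hMclosed : IsClosed M)
    (π : Matrix I I ℂ) (K₀ : ℝ) {B : ℝ} (hB : 0 ≤ B) :
    ∃ ν ∈ truncCone M B, ∃ A ∈ effects I,
      IsSaddlePointOn (truncCone M B) (effects I) (lagrangian π K₀) ν A := by
  have hcont : Continuous fun p : Matrix I I ℂ × Matrix I I ℂ => lagrangian π K₀ p.1 p.2 := by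
    unfold lagrangian
    fun_prop
  refine Sion.exists_isSaddlePointOn ?_ (convex_truncCone hMconv B) ?_ ?_ ?_ convex_effects
    ⟨0, .zero, by simpa using Matrix.PosSemidef.one⟩ isCompact_effects ?_ ?_
  · obtain ⟨σ, hσ⟩ := hMne
    exact ⟨_, (0, σ), ⟨⟨le_rfl, hB⟩, hσ⟩, rfl⟩
  · exact (isCompact_Icc.prod (isCompact_of_isClosed_of_isState hMstates hMclosed)).image
      continuous_smul
  · exact fun A _ =>
      (hcont.comp (Continuous.prodMk_left A)).lowerSemicontinuous.lowerSemicontinuousOn _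
  · refine fun A _ => ConvexOn.quasiconvexOn ⟨convex_truncCone hMconv B, ?_⟩
    intro x _ y _ a b _ _ hab
    obtain rfl := eq_sub_of_add_eq hab
    apply le_of_eq
    simp [lagrangian, mul_sub, mul_add]
    ring
  · exact fun ν _ =>
      (hcont.comp (Continuous.prodMk_right ν)).upperSemicontinuous.upperSemicontinuousOn _
  · refine fun ν _ => ConcaveOn.quasiconcaveOn ⟨convex_effects, ?_⟩
    intro x _ y _ a b _ _ hab
    obtain rfl := eq_sub_of_add_eq hab
    apply le_of_eq
    simp [lagrangian, add_mul]
    ring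

/-- Weak duality. -/
lemma re_trace_mul_le_trPos_add {A π μ : Matrix I I ℂ} (hA : A ∈ effects I)
    (hπ : π.IsHermitian) (hμ : μ.IsHermitian) {K₀ b : ℝ} (hb : 0 ≤ b)
    (hAμ : ((A * μ).trace).re ≤ 1 / K₀) :
    ((A * π).trace).re ≤ trPos (π - b • μ) + b / K₀ := by
  have h := re_trace_mul_le_trPos hA.1 hA.2 (hπ.sub (hμ.smul (IsSelfAdjoint.all b)))
  have hbμ := mul_le_mul_of_nonneg_left hAμ hb
  simp only [mul_sub, Matrix.mul_smul, Matrix.trace_sub, Matrix.trace_smul, Complex.sub_re,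
    Complex.real_smul, Complex.re_ofReal_mul] at h
  rw [mul_one_div] at hbμ
  linarith

/-- **Strong duality for the hypothesis-testing optimization.**  For a nonempty
closed convex set `M` of states containing a full-rank state, a state `π` and
`K₀ > 0`:
`max {tr(Aπ) : 0 ≤ A ≤ 1, tr(Aσ) ≤ 1/K₀ ∀σ ∈ M} =
 min {tr(π − bμ)₊ + b/K₀ : μ ∈ M, b ≥ 0}`. -/
theorem hypothesis_testing_duality {d : ℕ} (M : Set (Matrix (Fin d) (Fin d) ℂ))
    (hMne : M.Nonempty) (hMstates : ∀ σ ∈ M, IsState σ)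
    (hMconv : Convex ℝ M) (hMclosed : IsClosed M)
    (hfull : ∃ σ ∈ M, σ.PosDef)
    (π : Matrix (Fin d) (Fin d) ℂ) (hπ : IsState π)
    (K₀ : ℝ) (hK : 0 < K₀) :
    ∃ v : ℝ,
      IsGreatest {x : ℝ | ∃ A : Matrix (Fin d) (Fin d) ℂ,
        A.PosSemidef ∧ (1 - A).PosSemidef ∧
        (∀ σ ∈ M, ((A * σ).trace).re ≤ 1 / K₀) ∧ x = ((A * π).trace).re} v ∧
      IsLeast {x : ℝ | ∃ μ ∈ M, ∃ b : ℝ, 0 ≤ b ∧ x = trPos (π - b • μ) + b / K₀} v := by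
  obtain ⟨ν, ⟨⟨b, μ⟩, ⟨⟨hb0, -⟩, hμ⟩, rfl⟩, A, hA, hsaddle⟩ :=
    exists_isSaddlePointOn_lagrangian hMne hMstates hMconv hMclosed π K₀
      (B := 2 * K₀) (by positivity)
  simp only at hb0 hμ hsaddle
  have hzero : (0 : Matrix (Fin d) (Fin d) ℂ) ∈ truncCone M (2 * K₀) :=
    ⟨(0, μ), ⟨⟨le_rfl, by positivity⟩, hμ⟩, zero_smul _ _⟩
  have hzero_eff : (0 : Matrix (Fin d) (Fin d) ℂ) ∈ effects (Fin d) :=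
    ⟨.zero, by simpa using Matrix.PosSemidef.one⟩
  have hμtr := (hMstates μ hμ).2
  have hAπ : ((A * π).trace).re ≤ 1 := by
    have h := re_trace_mul_nonneg hA.2 hπ.1
    rw [sub_mul, one_mul, Matrix.trace_sub, hπ.2, Complex.sub_re, Complex.one_re] at h
    linarith
  have hbK : b ≤ K₀ := by
    have h := hsaddle 0 hzero 0 hzero_eff
    simp only [lagrangian, zero_mul, Matrix.trace_zero, Matrix.trace_smul, hμtr, sub_zero,
      Complex.zero_re, zero_add, zero_div, add_zero, Complex.smul_re, Complex.one_re, smul_eq_mul,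
      mul_one] at h
    exact (div_le_one hK).1 (h.trans hAπ)
  have hfeas : ∀ σ ∈ M, ((A * σ).trace).re ≤ 1 / K₀ := by
    intro σ hσ
    have hmem : b • μ + K₀ • σ ∈ truncCone M (2 * K₀) := by
      refine ⟨(b + K₀, (b / (b + K₀)) • μ + (K₀ / (b + K₀)) • σ),
        ⟨⟨by positivity, by linarith⟩,
          hMconv hμ hσ (by positivity) (by positivity) ?_⟩, ?_⟩
      · rw [← add_div, div_self (by positivity)]
      · simp only [smul_add, smul_smul, mul_div_cancel₀ _ (by positivity : b + K₀ ≠ 0)]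
    have h := hsaddle _ hmem A hA
    simp only [lagrangian, mul_sub, mul_add, Matrix.mul_smul, Matrix.trace_sub, Matrix.trace_add,
      Matrix.trace_smul, hμtr, (hMstates σ hσ).2, Complex.sub_re, Complex.add_re, Complex.smul_re,
      Complex.one_re, smul_eq_mul, mul_one, add_div, div_self hK.ne'] at h
    rw [le_div_iff₀ hK]
    linarith
  have hπH := hπ.1.isHermitian
  have hweak {A' : Matrix (Fin d) (Fin d) ℂ} (hA' : A' ∈ effects (Fin d))
      (hA'M : ∀ σ ∈ M, ((A' * σ).trace).re ≤ 1 / K₀) {μ' : Matrix (Fin d) (Fin d) ℂ}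
      (hμ' : μ' ∈ M) {b' : ℝ} (hb' : 0 ≤ b') :
      ((A' * π).trace).re ≤ trPos (π - b' • μ') + b' / K₀ :=
    re_trace_mul_le_trPos_add hA' hπH (hMstates μ' hμ').1.isHermitian hb' (hA'M μ' hμ')
  have hdual : trPos (π - b • μ) + b / K₀ ≤ ((A * π).trace).re := by
    obtain ⟨P, hP, hP', hPtr⟩ := exists_re_trace_mul_eq_trPos
      (hπH.sub ((hMstates μ hμ).1.isHermitian.smul (IsSelfAdjoint.all b)))
    have h := hsaddle 0 hzero P ⟨hP, hP'⟩
    simpa [lagrangian, hPtr, hμtr] using h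
  refine ⟨((A * π).trace).re, ⟨⟨A, hA.1, hA.2, hfeas, rfl⟩, ?_⟩,
    ⟨μ, hμ, b, hb0, (hweak hA hfeas hμ hb0).antisymm hdual⟩, ?_⟩
  · rintro _ ⟨A', hA', hA'', hA'M, rfl⟩
    exact (hweak ⟨hA', hA''⟩ hA'M hμ hb0).trans hdual
  · rintro _ ⟨μ', hμ', b', hb', rfl⟩
    exact hweak hA hfeas hμ' hb'

end GQSL
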